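/- Let k ≥ 3 and N ≥ 3 be integers, let G be a subgroup of SL(2,ℤ) with Γ(N) ⊆ G, let O ⊆ Λ_N be an orbit of the right G-action on Λ_N, and set F := Σ_{μ ∈ O} E_k(·, μ, N). Then for every γ ∈ SL(2,ℤ), the limit as the real number t → ∞ of (F|_k γ)(it) exists and equals [(0,1)·γ^{-1} ∈ O] + (−1)^k·[−(0,1)·γ^{-1} ∈ O], where [·] is the indicator taking the value 1 if the stated membership holds and 0 otherwise, and (0,1)·γ^{-1} is computed in (ℤ/Nℤ)². -/

import Mathlib

open scoped MatrixGroups Classical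
open Complex UpperHalfPlane Filter

noncomputable section

abbrev SL2Z := Matrix.SpecialLinearGroup (Fin 2) ℤ

/-- weight `k` slash action of `γ ∈ SL(2,ℤ)` on functions `ℍ → ℂ`. -/
def slashf (k : ℤ) (γ : SL2Z) (f : ℍ → ℂ) : ℍ → ℂ :=
  fun τ => (((γ 1 0 : ℤ) : ℂ) * (τ : ℂ) + ((γ 1 1 : ℤ) : ℂ)) ^ (-k) * f (γ • τ)

/-- normalized Eisenstein series of weight `k` on `Γ(N)` -/
def Ek (k N : ℕ) (lam : ZMod N × ZMod N) : ℍ → ℂ :=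
  fun τ => (if 3 ≤ N then (1 : ℂ) else 1/2) * ∑' cd : ℤ × ℤ,
    if Int.gcd cd.1 cd.2 = 1 ∧ (cd.1 : ZMod N) = lam.1 ∧ (cd.2 : ZMod N) = lam.2
    then ((cd.1 : ℂ) * (τ : ℂ) + (cd.2 : ℂ)) ^ (-(k : ℤ)) else 0

/-- right action of `SL(2,ℤ)` on row vectors mod `N` -/
def rmul {N : ℕ} (lam : ZMod N × ZMod N) (γ : SL2Z) : ZMod N × ZMod N :=
  (lam.1 * ((γ 0 0 : ℤ) : ZMod N) + lam.2 * ((γ 1 0 : ℤ) : ZMod N),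
   lam.1 * ((γ 0 1 : ℤ) : ZMod N) + lam.2 * ((γ 1 1 : ℤ) : ZMod N))

/-- `O` is an orbit of the right `G`-action on `Λ_N` -/
def isOrbit (N : ℕ) (G : Subgroup SL2Z) (O : Set (ZMod N × ZMod N)) : Prop :=
  ∃ lam : ZMod N × ZMod N, addOrderOf lam = N ∧ O = {μ | ∃ γ ∈ G, rmul lam γ = μ}

/-- the point `i·t` of the upper half plane, for `t > 0`. -/
def vpt (t : ℝ) (ht : 0 < t) : ℍ := ⟨⟨0, t⟩, ht⟩

theorem det_eq_one_fin_two (γ : SL2Z) : γ 0 0 * γ 1 1 - γ 0 1 * γ 1 0 = 1 := by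
  rw [← Matrix.det_fin_two]
  exact γ.det_coe

/-- `SL(2,ℤ)` acting on integral row vectors from the right. -/
def rowEquiv (γ : SL2Z) : ℤ × ℤ ≃ ℤ × ℤ where
  toFun v := (v.1 * γ 0 0 + v.2 * γ 1 0, v.1 * γ 0 1 + v.2 * γ 1 1)
  invFun v := (v.1 * γ 1 1 - v.2 * γ 1 0, -v.1 * γ 0 1 + v.2 * γ 0 0)
  left_inv v := by
    have h := det_eq_one_fin_two γ
    ext
    · linear_combination v.1 * h
    · linear_combination v.2 * h
  right_inv v := by
    have h := det_eq_one_fin_two γ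
    ext
    · linear_combination v.1 * h
    · linear_combination v.2 * h

theorem gcd_rowEquiv (γ : SL2Z) (v : ℤ × ℤ) :
    Int.gcd (rowEquiv γ v).1 (rowEquiv γ v).2 = 1 ↔ Int.gcd v.1 v.2 = 1 := by
  simp only [← Int.isCoprime_iff_gcd_eq_one]
  have h := det_eq_one_fin_two γ
  constructor
  · rintro ⟨a, b, hab⟩
    refine ⟨a * γ 0 0 + b * γ 0 1, a * γ 1 0 + b * γ 1 1, ?_⟩
    simp only [rowEquiv, Equiv.coe_fn_mk] at hab
    linear_combination hab
  · rintro ⟨a, b, hab⟩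
    refine ⟨a * γ 1 1 - b * γ 0 1, -a * γ 1 0 + b * γ 0 0, ?_⟩
    simp only [rowEquiv, Equiv.coe_fn_mk]
    linear_combination hab + (a * v.1 + b * v.2) * h

theorem rmul_mul {N : ℕ} (v : ZMod N × ZMod N) (γ δ : SL2Z) :
    rmul (rmul v γ) δ = rmul v (γ * δ) := by
  ext <;> simp [rmul, Matrix.mul_apply, Fin.sum_univ_two] <;> ring

theorem rmul_one {N : ℕ} (v : ZMod N × ZMod N) : rmul v 1 = v := by
  ext <;> simp [rmul]

theorem rmul_neg {N : ℕ} (v : ZMod N × ZMod N) (γ : SL2Z) : rmul (-v) γ = -rmul v γ := by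
  ext <;> simp [rmul] <;> ring

theorem rmul_eq_iff {N : ℕ} (v w : ZMod N × ZMod N) (γ : SL2Z) :
    rmul v γ = w ↔ v = rmul w γ⁻¹ := by
  constructor
  · rintro rfl
    rw [rmul_mul, mul_inv_cancel, rmul_one]
  · rintro rfl
    rw [rmul_mul, inv_mul_cancel, rmul_one]

theorem intCast_rowEquiv_eq_rmul_iff {N : ℕ} (γ : SL2Z) (v : ℤ × ℤ) (lam : ZMod N × ZMod N) :
    (((rowEquiv γ v).1 : ZMod N) = (rmul lam γ).1 ∧ ((rowEquiv γ v).2 : ZMod N) = (rmul lam γ).2) ↔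
      ((v.1 : ZMod N) = lam.1 ∧ (v.2 : ZMod N) = lam.2) := by
  have key : (((rowEquiv γ v).1 : ZMod N), ((rowEquiv γ v).2 : ZMod N)) =
      rmul ((v.1 : ZMod N), (v.2 : ZMod N)) γ := by
    ext <;> simp [rowEquiv, rmul]
  rw [← Prod.ext_iff (x := (((rowEquiv γ v).1 : ZMod N), ((rowEquiv γ v).2 : ZMod N))), key,
    rmul_eq_iff, rmul_mul, mul_inv_cancel, rmul_one, Prod.ext_iff]

theorem linear_smul_mul_denom (γ : SL2Z) (v : ℤ × ℤ) (τ : ℍ) :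
    ((γ 1 0 : ℂ) * τ + γ 1 1) * (v.1 * ((γ • τ : ℍ) : ℂ) + v.2) =
      ((rowEquiv γ v).1 : ℂ) * τ + (rowEquiv γ v).2 := by
  have hd : (γ 1 0 : ℂ) * τ + γ 1 1 ≠ 0 := by
    simpa [denom] using denom_ne_zero (γ : GL (Fin 2) ℝ) τ
  rw [coe_specialLinearGroup_apply]
  simp only [rowEquiv, Equiv.coe_fn_mk, algebraMap_int_eq, eq_intCast, ofReal_intCast]
  field_simp
  push_cast
  ring

/-- Slashing by `γ` permutes the Eisenstein series of level `N`. -/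
theorem slashf_Ek (k N : ℕ) (lam : ZMod N × ZMod N) (γ : SL2Z) :
    slashf k γ (Ek k N lam) = Ek k N (rmul lam γ) := by
  funext τ
  simp only [slashf, Ek]
  rw [mul_left_comm, ← tsum_mul_left]
  conv_rhs => rw [← (rowEquiv γ).tsum_eq]
  congr 2
  funext v
  simp only [gcd_rowEquiv, intCast_rowEquiv_eq_rmul_iff, mul_ite, mul_zero, ← mul_zpow,
    linear_smul_mul_denom]

theorem tendsto_vpt_summand {k : ℕ} (hk : k ≠ 0) {c : ℤ} (hc : c ≠ 0) (d : ℤ) :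
    Tendsto (fun t : {t : ℝ // 0 < t} => ((c : ℂ) * (vpt t t.2 : ℂ) + d) ^ (-(k : ℤ)))
      atTop (nhds 0) := by
  have hval : Tendsto (fun t : {t : ℝ // 0 < t} => (t : ℝ)) atTop atTop :=
    tendsto_comp_val_Ioi_atTop.mpr tendsto_id
  have hnorm : Tendsto (fun t : {t : ℝ // 0 < t} => ‖(c : ℂ) * (vpt t t.2 : ℂ) + d‖)
      atTop atTop := by
    refine tendsto_atTop_mono (fun t => ?_)
      (hval.const_mul_atTop (abs_pos.mpr (Int.cast_ne_zero.mpr hc : (c : ℝ) ≠ 0)))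
    refine le_trans (le_of_eq ?_) (abs_im_le_norm _)
    simp [vpt, abs_mul, abs_of_pos t.2]
  have hinv := ((tendsto_inv₀_cobounded (α := ℂ)).comp
    (tendsto_norm_atTop_iff_cobounded.mp hnorm)).pow k
  rw [zero_pow hk] at hinv
  refine hinv.congr fun t => ?_
  simp [zpow_neg]

theorem tsum_constant_term (k N : ℕ) (lam : ZMod N × ZMod N) :
    (∑' v : ℤ × ℤ, if v.1 = 0 then
      (if Int.gcd v.1 v.2 = 1 ∧ (v.1 : ZMod N) = lam.1 ∧ (v.2 : ZMod N) = lam.2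
        then (v.2 : ℂ) ^ (-(k : ℤ)) else 0) else 0) =
      (if lam = (0, 1) then 1 else 0) + (-1) ^ k * (if lam = -(0, 1) then 1 else 0) := by
  rw [tsum_eq_sum (s := {(0, 1), (0, -1)})]
  · rw [Finset.sum_pair (by simp)]
    have hpow : (-1 : ℂ) ^ (-(k : ℤ)) = (-1) ^ k := by
      rw [zpow_neg, zpow_natCast, ← inv_pow, inv_neg, inv_one]
    simp [Prod.ext_iff, eq_comm, hpow]
  · rintro ⟨c, d⟩ hv
    simp only [ite_eq_right_iff]
    rintro rfl ⟨hg, -⟩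
    rw [Int.gcd_zero_left, Int.natAbs_eq_iff] at hg
    rcases hg with rfl | rfl <;> simp at hv

/-- The constant term at `i∞` of an Eisenstein series of level `N ≥ 3`. -/
theorem tendsto_Ek (k N : ℕ) (hk : 3 ≤ k) (hN : 3 ≤ N) (lam : ZMod N × ZMod N) :
    Tendsto (fun t : {t : ℝ // 0 < t} => Ek k N lam (vpt t t.2)) atTop
      (nhds ((if lam = (0, 1) then 1 else 0) + (-1) ^ k * (if lam = -(0, 1) then 1 else 0))) := by
  simp only [Ek, if_pos hN, one_mul]
  rw [← tsum_constant_term]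
  have hk' : (2 : ℝ) < k := by exact_mod_cast hk
  refine tendsto_tsum_of_dominated_convergence
    (((finTwoArrowEquiv ℤ).symm.summable_iff.mpr
      (EisensteinSeries.summable_one_div_norm_rpow hk')).mul_left
        (EisensteinSeries.r (⟨⟨0, 1⟩, one_pos⟩ : ℍ) ^ (-(k : ℝ)))) (fun v => ?_) ?_
  · split_ifs with hv hc
    · simp [hc]
    · exact tendsto_vpt_summand (by omega) hc v.2
    · exact tendsto_const_nhds
    · exact tendsto_const_nhds
  · filter_upwards [eventually_ge_atTop (⟨1, one_pos⟩ : {t : ℝ // 0 < t})] with t ht v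
    have hb := EisensteinSeries.summand_bound_of_mem_verticalStrip (z := vpt t t.2)
      (k := (k : ℝ)) (by positivity) ![v.1, v.2] (A := 0) (B := 1) one_pos
      ⟨by simp [vpt, UpperHalfPlane.re], ht⟩
    have hv : (finTwoArrowEquiv ℤ).symm v = ![v.1, v.2] := rfl
    simp only [Function.comp_apply, hv]
    split_ifs
    · rw [norm_zpow, ← Real.rpow_intCast]
      simpa using hb
    · rw [norm_zero]
      exact mul_nonneg (Real.rpow_nonneg (EisensteinSeries.r_pos _).le _)
        (Real.rpow_nonneg (norm_nonneg _) _)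

/-- For `k ≥ 3`, `N ≥ 3`, `Γ(N) ⊆ G` and a `G`-orbit `O ⊆ Λ_N`, the
constant term of `F := Σ_{μ ∈ O} E_k(·,μ,N)` slashed by any `γ ∈ SL(2,ℤ)` equals
`[(0,1)γ⁻¹ ∈ O] + (−1)^k·[−(0,1)γ⁻¹ ∈ O]`. -/
theorem constant_term_orbital_sum (k N : ℕ) (hk : 3 ≤ k) (hN : 3 ≤ N)
    (G : Subgroup SL2Z) (hG : CongruenceSubgroup.Gamma N ≤ G)
    (O : Set (ZMod N × ZMod N)) (hO : isOrbit N G O) (γ : SL2Z) :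
    Tendsto
      (fun t : {t : ℝ // 0 < t} =>
        slashf (k : ℤ) γ (fun τ => ∑' μ : O, Ek k N (μ : ZMod N × ZMod N) τ) (vpt t t.2))
      atTop
      (nhds ((if rmul ((0 : ZMod N), (1 : ZMod N)) γ⁻¹ ∈ O then (1 : ℂ) else 0) +
        (-1 : ℂ) ^ k *
          (if -(rmul ((0 : ZMod N), (1 : ZMod N)) γ⁻¹) ∈ O then (1 : ℂ) else 0))) := by
  have : NeZero N := ⟨by omega⟩
  have hslash : ∀ τ : ℍ, slashf (k : ℤ) γ (fun τ => ∑' μ : O, Ek k N μ τ) τ =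
      ∑ μ : O, Ek k N (rmul μ γ) τ := by
    intro τ
    simp only [← slashf_Ek, slashf, tsum_fintype, Finset.mul_sum]
  have hsum : ∀ a : ZMod N × ZMod N,
      ∑ μ : O, (if (μ : ZMod N × ZMod N) = a then (1 : ℂ) else 0) = if a ∈ O then 1 else 0 := by
    intro a
    rw [← Finset.sum_subtype (Finset.univ.filter (· ∈ O)) (by simp)
      (fun μ => if μ = a then (1 : ℂ) else 0), Finset.sum_ite_eq']
    simp
  simp only [hslash]
  rw [← hsum, ← hsum, Finset.mul_sum, ← Finset.sum_add_distrib]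
  refine tendsto_finsetSum _ fun μ _ => ?_
  simpa only [rmul_eq_iff, rmul_neg] using tendsto_Ek k N hk hN (rmul μ γ)
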